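/- Let m, n ≥ 1 and let Γ_{m,n} be the presented group ⟨x_m, t_m, x_n, t_n | ρ_m(x_m,t_m), ρ_n(x_n,t_n), x_m^m, x_n^n⟩. Then Γ_{m,n} is virtually free: it has a subgroup of finite index that is a free group. -/

import Mathlib

/-- The word `ρ_k(x,t) = (t x t⁻¹) x (t x t⁻¹)⁻¹ x^{-(k+1)}`, evaluated at elements
`x`, `t` of a group. -/
def rhoWord {G : Type*} [Group G] (k : ℕ) (x t : G) : G :=
  (t * x * t⁻¹) * x * (t * x * t⁻¹)⁻¹ * x ^ (-(k + 1 : ℤ))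

/-- If `x ^ m = 1` then the relator `ρ_m(x, t)` only says that `t x t⁻¹` commutes with `x`. -/
lemma rhoWord_eq_one_of_commute {G : Type*} [Group G] {m : ℕ} {x t : G} (hx : x ^ m = 1)
    (h : Commute (t * x * t⁻¹) x) : rhoWord m x t = 1 := by
  have hpow : x ^ (-(m + 1 : ℤ)) = x⁻¹ := by
    rw [zpow_neg, zpow_add, zpow_natCast, hx, one_mul, zpow_one]
  rw [rhoWord, hpow, h.eq, mul_inv_cancel_right, mul_inv_cancel]

lemma commute_of_rhoWord_eq_one {G : Type*} [Group G] {m : ℕ} {x t : G} (hx : x ^ m = 1)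
    (h : rhoWord m x t = 1) : Commute (t * x * t⁻¹) x := by
  have hpow : x ^ (-(m + 1 : ℤ)) = x⁻¹ := by
    rw [zpow_neg, zpow_add, zpow_natCast, hx, one_mul, zpow_one]
  rw [rhoWord, hpow, mul_inv_eq_one, mul_inv_eq_iff_eq_mul] at h
  exact h

lemma map_rhoWord {G H : Type*} [Group G] [Group H] (f : G →* H) (m : ℕ) (x t : G) :
    f (rhoWord m x t) = rhoWord m (f x) (f t) := by
  simp [rhoWord]

lemma rhoWord_conj_mul_eq_one {G : Type*} [Group G] {m : ℕ} {x s u : G} (v : G) (hx : x ^ m = 1)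
    (hu : Commute u x) (hs : Commute (s * x * s⁻¹) x) :
    rhoWord m (v * x * v⁻¹) (v * (s * u) * v⁻¹) = 1 := by
  have hconj : s * u * x * (s * u)⁻¹ = s * x * s⁻¹ := by
    rw [mul_assoc s, hu.eq]
    group
  have h : rhoWord m x (s * u) = 1 := rhoWord_eq_one_of_commute hx (hconj ▸ hs)
  simpa [h] using (map_rhoWord (MulAut.conj v).toMonoidHom m x (s * u)).symm

section FreeByFinite

variable {P Q : Type*} [Group P] [Group Q]

/-- The action of `Q` on the free group on the underlying set of `P`, by conjugation of the
generators through `σ : Q →* P`. -/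
def freeConjAction (σ : Q →* P) : Q →* MulAut (FreeGroup P) where
  toFun q := FreeGroup.freeGroupCongr (MulAut.conj (σ q)).toEquiv
  map_one' := by
    apply MulEquiv.toMonoidHom_injective
    ext p
    simp
  map_mul' a b := by
    apply MulEquiv.toMonoidHom_injective
    ext p
    simp [mul_assoc]

lemma freeConjAction_of (σ : Q →* P) (q : Q) (p : P) :
    freeConjAction σ q (FreeGroup.of p) = FreeGroup.of (σ q * p * (σ q)⁻¹) := by
  simp [freeConjAction]

/-- The evaluation `F(P) ⋊ Q →* P` which is the identity on generators and `σ` on `Q`. -/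
def freeConjEval (σ : Q →* P) : FreeGroup P ⋊[freeConjAction σ] Q →* P :=
  SemidirectProduct.lift (FreeGroup.lift id) σ fun q => by
    ext p
    simp [freeConjAction_of]

/-- A group embedding into the extension of a finite group by a free group is virtually free. -/
lemma exists_finiteIndex_isFreeGroup {G F : Type*} [Group G] [Group F] [IsFreeGroup F] [Finite Q]
    {α : Q →* MulAut F} (f : G →* F ⋊[α] Q) (hf : Function.Injective f) :
    ∃ H : Subgroup G, H.FiniteIndex ∧ IsFreeGroup H := by
  let r : G →* Q := SemidirectProduct.rightHom.comp f
  have hr : ∀ h : r.ker, (f h).right = 1 := fun h => h.2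
  let l : r.ker →* F :=
    { toFun := fun h => (f h).left
      map_one' := by simp
      map_mul' := fun a b => by simp [hr] }
  have hl : Function.Injective l := fun a b hab =>
    Subtype.ext (hf (SemidirectProduct.ext hab ((hr a).trans (hr b).symm)))
  exact ⟨r.ker, inferInstance, IsFreeGroup.ofMulEquiv (MonoidHom.ofInjective hl).symm⟩

end FreeByFinite

section Diagonal

variable {G T : Type*} [Group G]

/-- The action of `Perm S` on `S × T` through the first factor. -/
def fstPerm (S T : Type*) : Equiv.Perm S →* Equiv.Perm (S × T) where
  toFun q := Equiv.prodCongr q (Equiv.refl T)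
  map_one' := rfl
  map_mul' _ _ := rfl

/-- The action of `Perm T` on `S × T` through the second factor. -/
def sndPerm (S T : Type*) : Equiv.Perm T →* Equiv.Perm (S × T) where
  toFun q := Equiv.prodCongr (Equiv.refl S) q
  map_one' := rfl
  map_mul' _ _ := rfl

/-- The diagonal action of `G` on `G × T`, for `G` acting on `T` through `ψ`. -/
def diagPerm (ψ : G →* Equiv.Perm T) : G →* Equiv.Perm (G × T) where
  toFun g := Equiv.prodCongr (Equiv.mulLeft g) (ψ g)
  map_one' := by ext p <;> simp
  map_mul' a b := by ext p <;> simp [mul_assoc]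

lemma diagPerm_injective [Nonempty T] (ψ : G →* Equiv.Perm T) :
    Function.Injective (diagPerm ψ) := fun a b hab => by
  obtain ⟨p⟩ := ‹Nonempty T›
  simpa [diagPerm] using congrArg Prod.fst (Equiv.congr_fun hab (1, p))

/-- The shear of `G × T` along a map `φ : T → G`. -/
def shearPerm (φ : T → G) : Equiv.Perm (G × T) where
  toFun z := (φ z.2 * z.1, z.2)
  invFun z := ((φ z.2)⁻¹ * z.1, z.2)
  left_inv z := by simp
  right_inv z := by simp

lemma shearPerm_mul_sndPerm {ψ : G →* Equiv.Perm T} {φ : T → G} {a : G}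
    (h : ∀ p, φ (ψ a p) = a * φ p) :
    shearPerm φ * sndPerm G T (ψ a) = diagPerm ψ a * shearPerm φ := by
  ext z
  · change φ (ψ a z.2) * z.1 = a * (φ z.2 * z.1)
    rw [h, mul_assoc]
  · rfl

/-- Let `x ^ m = 1` and `ρ_m(x, t) = 1`. If some `φ : T → G` is equivariant for `x` and `t x t⁻¹`,
then the diagonal permutations of `x` and `t` lift along the evaluation map to a pair satisfying
the same relations. -/
lemma exists_lift_pair (ψ : G →* Equiv.Perm T) (φ : T → G) {m : ℕ} {x t : G} (hx : x ^ m = 1)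
    (hρ : rhoWord m x t = 1) (hφx : ∀ p, φ (ψ x p) = x * φ p)
    (hφy : ∀ p, φ (ψ (t * x * t⁻¹) p) = t * x * t⁻¹ * φ p) :
    ∃ x' t' : FreeGroup (Equiv.Perm (G × T)) ⋊[freeConjAction (sndPerm G T)] Equiv.Perm T,
      x' ^ m = 1 ∧ rhoWord m x' t' = 1 ∧
        freeConjEval (sndPerm G T) x' = diagPerm ψ x ∧
        freeConjEval (sndPerm G T) t' = diagPerm ψ t := by
  set θ := shearPerm φ
  set σ := sndPerm G T
  set δ := diagPerm ψ
  have hθx : θ * σ (ψ x) = δ x * θ := shearPerm_mul_sndPerm hφx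
  have hθy : θ * σ (ψ (t * x * t⁻¹)) = δ (t * x * t⁻¹) * θ := shearPerm_mul_sndPerm hφy
  set u := (σ (ψ t))⁻¹ * θ⁻¹ * δ t * θ with hu
  have hux : σ (ψ x) * u * (σ (ψ x))⁻¹ = u := by
    rw [mul_inv_eq_iff_eq_mul]
    have hy : σ (ψ t) * σ (ψ x) * (σ (ψ t))⁻¹ = θ⁻¹ * (δ t * δ x * (δ t)⁻¹) * θ := by
      simp only [map_mul, map_inv] at hθy
      rw [mul_assoc θ⁻¹, eq_inv_mul_iff_mul_eq, hθy]
    have hx' : σ (ψ x) = θ⁻¹ * δ x * θ := by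
      rw [mul_assoc, eq_inv_mul_iff_mul_eq, hθx]
    calc σ (ψ x) * u
        = (σ (ψ t))⁻¹ * (σ (ψ t) * σ (ψ x) * (σ (ψ t))⁻¹) * θ⁻¹ * δ t * θ := by
          rw [hu]; group
      _ = (σ (ψ t))⁻¹ * θ⁻¹ * δ t * θ * (θ⁻¹ * δ x * θ) := by rw [hy]; group
      _ = u * σ (ψ x) := by rw [← hx', hu]
  let E := FreeGroup (Equiv.Perm (G × T)) ⋊[freeConjAction σ] Equiv.Perm T
  let gen : Equiv.Perm (G × T) → E := fun p => SemidirectProduct.inl (FreeGroup.of p)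
  let i : Equiv.Perm T →* E := SemidirectProduct.inr
  have hgen : ∀ p, freeConjEval σ (gen p) = p := fun p => by simp [gen, freeConjEval]
  have hi : ∀ q, freeConjEval σ (i q) = σ q := fun q => SemidirectProduct.lift_inr ..
  have hcomm : Commute (gen u) (i (ψ x)) := by
    have h := SemidirectProduct.inl_aut (φ := freeConjAction σ) (ψ x) (FreeGroup.of u)
    rw [freeConjAction_of, hux, map_inv, eq_mul_inv_iff_mul_eq] at h
    exact h
  have hpow : (gen θ * i (ψ x) * (gen θ)⁻¹) ^ m = 1 := by
    rw [conj_pow, ← map_pow, ← map_pow, hx]; simp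
  refine ⟨gen θ * i (ψ x) * (gen θ)⁻¹, gen θ * (i (ψ t) * gen u) * (gen θ)⁻¹, hpow, ?_, ?_, ?_⟩
  · have hy := ((commute_of_rhoWord_eq_one hx hρ).map ψ).map i
    simp only [map_mul, map_inv] at hy
    exact rhoWord_conj_mul_eq_one _ (by rw [← map_pow, ← map_pow, hx, map_one, map_one]) hcomm hy
  · simp only [map_mul, map_inv, hgen, hi]
    rw [hθx, mul_inv_cancel_right]
  · simp only [map_mul, map_inv, hgen, hi, hu]
    group

end Diagonal

section Torus

/-- The translation `(a, b) ↦ (a + 1, b)` of `(ℤ/m)²`. -/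
def torusShift (m : ℕ) : Equiv.Perm (ZMod m × ZMod m) :=
  Equiv.prodCongr (Equiv.addLeft 1) (Equiv.refl _)

/-- The coordinate swap of `(ℤ/m)²`. -/
def torusSwap (m : ℕ) : Equiv.Perm (ZMod m × ZMod m) := Equiv.prodComm _ _

lemma torusShift_pow (m : ℕ) : torusShift m ^ m = 1 := by
  have h : ∀ (k : ℕ) (p : ZMod m × ZMod m), (torusShift m ^ k) p = (k + p.1, p.2) := by
    intro k
    induction k with
    | zero => simp
    | succ k ih =>
      intro p
      rw [pow_succ', Equiv.Perm.mul_apply, ih]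
      simp only [torusShift, Equiv.prodCongr_apply, Prod.map, Equiv.coe_addLeft, Equiv.refl_apply]
      push_cast
      rw [add_left_comm, ← add_assoc]
  ext p <;> simp [h]

lemma rhoWord_torus (m : ℕ) : rhoWord m (torusShift m) (torusSwap m) = 1 := by
  apply rhoWord_eq_one_of_commute (torusShift_pow m)
  ext p <;> rfl

lemma pow_val_one_add {G : Type*} [Group G] {m : ℕ} [NeZero m] {x : G} (hx : x ^ m = 1)
    (a : ZMod m) : x ^ (1 + a).val = x * x ^ a.val := by
  rw [ZMod.val_add, ← pow_succ', ZMod.val_one_eq_one_mod, Nat.mod_add_mod, add_comm 1,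
    ← pow_eq_pow_mod _ hx]

/-- The map `(ℤ/m)² → G`, `(a, b) ↦ x ^ a (t x t⁻¹) ^ b`. -/
def conjMap {G : Type*} [Group G] (m : ℕ) (x t : G) (p : ZMod m × ZMod m) : G :=
  x ^ p.1.val * (t * x * t⁻¹) ^ p.2.val

variable {G : Type*} [Group G] {m : ℕ} [NeZero m] {x t : G}

lemma conjMap_shift (hx : x ^ m = 1) (p : ZMod m × ZMod m) :
    conjMap m x t (torusShift m p) = x * conjMap m x t p := by
  simp [conjMap, torusShift, pow_val_one_add hx, mul_assoc]

lemma conjMap_conj_shift (hx : x ^ m = 1) (hρ : rhoWord m x t = 1) (p : ZMod m × ZMod m) :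
    conjMap m x t ((torusSwap m * torusShift m * (torusSwap m)⁻¹) p) =
      t * x * t⁻¹ * conjMap m x t p := by
  have hy : (t * x * t⁻¹) ^ m = 1 := by rw [conj_pow, hx]; simp
  have h : (torusSwap m * torusShift m * (torusSwap m)⁻¹) p = (p.1, 1 + p.2) := rfl
  have hc := ((commute_of_rhoWord_eq_one hx hρ).pow_right p.1.val).eq
  simp only [h, conjMap]
  rw [pow_val_one_add hy, ← mul_assoc, ← hc, mul_assoc]

end Torus

/-- For `m, n ≥ 1`, the presented group
`Γ_{m,n} = ⟨x_m, t_m, x_n, t_n | ρ_m(x_m,t_m), ρ_n(x_n,t_n), x_m^m, x_n^n⟩` is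
virtually free: it has a subgroup of finite index that is a free group. -/
theorem Gamma_virtually_free (m n : ℕ) (hm : 1 ≤ m) (hn : 1 ≤ n)
    (xm tm xn tn : FreeGroup (Fin 4))
    (hxm : xm = FreeGroup.of 0) (htm : tm = FreeGroup.of 1)
    (hxn : xn = FreeGroup.of 2) (htn : tn = FreeGroup.of 3) :
    ∃ H : Subgroup (PresentedGroup
        ({rhoWord m xm tm, rhoWord n xn tn, xm ^ m, xn ^ n} :
          Set (FreeGroup (Fin 4)))),
      H.FiniteIndex ∧ IsFreeGroup H := by
  have : NeZero m := ⟨by omega⟩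
  have : NeZero n := ⟨by omega⟩
  set rels : Set (FreeGroup (Fin 4)) :=
    {rhoWord m xm tm, rhoWord n xn tn, xm ^ m, xn ^ n} with hrels
  have hlift : ∀ {K : Type} [Group K] (a : Fin 4 → K), a 0 ^ m = 1 → a 2 ^ n = 1 →
      rhoWord m (a 0) (a 1) = 1 → rhoWord n (a 2) (a 3) = 1 →
      ∀ r ∈ rels, FreeGroup.lift a r = 1 := by
    intro K _ a h0 h2 h01 h23 r hr
    rcases hr with rfl | rfl | rfl | rfl <;>
      simp [map_rhoWord, hxm, htm, hxn, htn, h0, h2, h01, h23]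
  let g : Fin 4 → PresentedGroup rels := PresentedGroup.of
  have hmk : ∀ r ∈ rels, PresentedGroup.mk rels r = 1 := fun r hr =>
    PresentedGroup.one_of_mem hr
  have hg : ∀ i, PresentedGroup.mk rels (FreeGroup.of i) = g i := fun _ => rfl
  have hg0 : g 0 ^ m = 1 := by simpa [hxm, hg] using hmk (xm ^ m) (by simp [hrels])
  have hg2 : g 2 ^ n = 1 := by simpa [hxn, hg] using hmk (xn ^ n) (by simp [hrels])
  have hg01 : rhoWord m (g 0) (g 1) = 1 := by
    simpa [hxm, htm, map_rhoWord, hg] using hmk (rhoWord m xm tm) (by simp [hrels])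
  have hg23 : rhoWord n (g 2) (g 3) = 1 := by
    simpa [hxn, htn, map_rhoWord, hg] using hmk (rhoWord n xn tn) (by simp [hrels])
  let T := (ZMod m × ZMod m) × (ZMod n × ZMod n)
  let j₁ : Equiv.Perm (ZMod m × ZMod m) →* Equiv.Perm T := fstPerm _ _
  let j₂ : Equiv.Perm (ZMod n × ZMod n) →* Equiv.Perm T := sndPerm _ _
  let b : Fin 4 → Equiv.Perm T :=
    ![j₁ (torusShift m), j₁ (torusSwap m), j₂ (torusShift n), j₂ (torusSwap n)]
  let ψ : PresentedGroup rels →* Equiv.Perm T := PresentedGroup.toGroup (f := b) <| hlift b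
    (by change j₁ _ ^ m = 1; rw [← map_pow, torusShift_pow, map_one])
    (by change j₂ _ ^ n = 1; rw [← map_pow, torusShift_pow, map_one])
    (by change rhoWord m (j₁ _) (j₁ _) = 1; rw [← map_rhoWord, rhoWord_torus, map_one])
    (by change rhoWord n (j₂ _) (j₂ _) = 1; rw [← map_rhoWord, rhoWord_torus, map_one])
  have hψ : ∀ i, ψ (g i) = b i := fun i => PresentedGroup.toGroup.of _
  obtain ⟨x₁, t₁, hx₁, hρ₁, hex₁, het₁⟩ := exists_lift_pair ψ
    (fun p => conjMap m (g 0) (g 1) p.1) hg0 hg01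
    (fun p => by rw [hψ]; exact conjMap_shift hg0 p.1)
    (fun p => by
      simp only [map_mul, map_inv, hψ]; exact conjMap_conj_shift hg0 hg01 p.1)
  obtain ⟨x₂, t₂, hx₂, hρ₂, hex₂, het₂⟩ := exists_lift_pair ψ
    (fun p => conjMap n (g 2) (g 3) p.2) hg2 hg23
    (fun p => by rw [hψ]; exact conjMap_shift hg2 p.2)
    (fun p => by
      simp only [map_mul, map_inv, hψ]; exact conjMap_conj_shift hg2 hg23 p.2)
  let f := PresentedGroup.toGroup (hlift ![x₁, t₁, x₂, t₂] hx₁ hx₂ hρ₁ hρ₂)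
  have hf : (freeConjEval (sndPerm (PresentedGroup rels) T)).comp f = diagPerm ψ := by
    apply PresentedGroup.ext
    intro i
    rw [MonoidHom.comp_apply, PresentedGroup.toGroup.of]
    fin_cases i
    exacts [hex₁, het₁, hex₂, het₂]
  refine exists_finiteIndex_isFreeGroup f (Function.Injective.of_comp
    (f := freeConjEval (sndPerm (PresentedGroup rels) T)) ?_)
  rw [← MonoidHom.coe_comp, hf]
  exact diagPerm_injective ψ
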